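/- Fix real numbers p01, p11 with 0 ≤ p11 < p01 ≤ 1 and a belief vector ω = (ω1, ω2, ω3, ω4) with 1 ≥ ω1 ≥ ω2 ≥ ω3 ≥ ω4 ≥ 0 (so N = 4 channels). Then for every two-slot sense-two policy (every choice of a first-slot pair {a,b} of distinct indices in {1,2,3,4} and of observation-dependent second-slot pairs {c_s,d_s}), the expected two-slot reward V satisfies V ≤ R*₋, where R*₋ = [1 − (1−ω1)(1−ω2)] + ω1ω2[1 − (1−τ(ω3))(1−τ(ω4))] + [ω1(1−ω2) + (1−ω1)ω2]·[1 − (1−p01)(1−τ(ω4))] + (1−ω1)(1−ω2)[1 − (1−p01)²]. (R*₋ is the expected two-slot reward of the myopic policy; hence the myopic sensing policy is optimal for T = 2, k = 2, N = 4 when p11 < p01.) -/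

import Mathlib

/-- Belief update operator `τ(ω) = ω·p11 + (1−ω)·p01`. -/
noncomputable def tau (p01 p11 w : ℝ) : ℝ := w * p11 + (1 - w) * p01

/-- Updated belief after sensing channels `a`,`b` with observation outcome
`s : Bool × Bool` (`true` = idle, `false` = busy). -/
noncomputable def nu (p01 p11 : ℝ) {N : ℕ} (ω : Fin N → ℝ) (a b : Fin N)
    (s : Bool × Bool) (i : Fin N) : ℝ :=
  if i = a then (if s.1 then p11 else p01)
  else if i = b then (if s.2 then p11 else p01)
  else tau p01 p11 (ω i)

/-- Probability of observation outcome `s` when sensing channels `a`,`b`. -/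
noncomputable def outcomeProb {N : ℕ} (ω : Fin N → ℝ) (a b : Fin N)
    (s : Bool × Bool) : ℝ :=
  (if s.1 then ω a else 1 - ω a) * (if s.2 then ω b else 1 - ω b)

/-- Expected two-slot reward of the policy sensing `{a,b}` in the first slot and,
after outcome `s`, the pair `{c s, d s}` in the second slot. -/
noncomputable def policyReward (p01 p11 : ℝ) {N : ℕ} (ω : Fin N → ℝ) (a b : Fin N)
    (c d : (Bool × Bool) → Fin N) : ℝ :=
  (1 - (1 - ω a) * (1 - ω b)) +
    ∑ s : Bool × Bool,
      outcomeProb ω a b s *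
        (1 - (1 - nu p01 p11 ω a b s (c s)) * (1 - nu p01 p11 ω a b s (d s)))

/-- The expected two-slot loss when channels with beliefs `a`, `b` are sensed first and the two
channels most likely to be idle are sensed next, the unsensed channels having beliefs `v ≤ u`. -/
noncomputable def greedyLoss (p01 p11 a b u v : ℝ) : ℝ :=
  (1 - a) * (1 - b) + a * b * ((1 - tau p01 p11 u) * (1 - tau p01 p11 v))
    + (a * (1 - b) + (1 - a) * b) * ((1 - p01) * (1 - tau p01 p11 v))
    + (1 - a) * (1 - b) * ((1 - p01) * (1 - p01))

lemma greedyLoss_comm (p01 p11 a b u v : ℝ) :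
    greedyLoss p01 p11 a b u v = greedyLoss p01 p11 b a u v := by
  unfold greedyLoss
  ring

lemma tau_le {p01 p11 w : ℝ} (h : p11 ≤ p01) (hw : 0 ≤ w) : tau p01 p11 w ≤ p01 := by
  unfold tau
  nlinarith [mul_nonneg hw (sub_nonneg.2 h)]

lemma le_tau {p01 p11 w : ℝ} (h : p11 ≤ p01) (hw : w ≤ 1) : p11 ≤ tau p01 p11 w := by
  unfold tau
  nlinarith [mul_nonneg (sub_nonneg.2 hw) (sub_nonneg.2 h)]

lemma tau_anti {p01 p11 : ℝ} (h : p11 ≤ p01) : Antitone (tau p01 p11) := by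
  intro v u hvu
  unfold tau
  nlinarith [mul_nonneg (sub_nonneg.2 hvu) (sub_nonneg.2 h)]

/-- Sensing the channel more likely to be idle is better, when neither channel is the least
likely to be idle among the unsensed ones. -/
lemma greedyLoss_le_swap_left {p01 p11 a b u v : ℝ} (hp0 : 0 ≤ p11) (hp1 : p11 ≤ p01)
    (hp2 : p01 ≤ 1) (ha : a ≤ 1) (hv0 : 0 ≤ v) (hv1 : v ≤ 1) (hub : u ≤ b) :
    greedyLoss p01 p11 a b u v ≤ greedyLoss p01 p11 a u b v := by
  have h1 : 1 - tau p01 p11 v ≤ 1 := by linarith [le_tau hp1 hv1]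
  have h0 : 0 ≤ 1 - tau p01 p11 v := by linarith [tau_le hp1 hv0]
  have h2 : (1 - p01) * (1 - tau p01 p11 v) ≤ 1 := mul_le_one₀ (by linarith) h0 h1
  have key : 0 ≤ (b - u) * ((1 - a) *
      ((1 - (1 - p01) * (1 - tau p01 p11 v)) + (1 - p01) * (1 - p01))) :=
    mul_nonneg (by linarith) (mul_nonneg (by linarith)
      (add_nonneg (by linarith) (mul_self_nonneg _)))
  have e : greedyLoss p01 p11 a u b v - greedyLoss p01 p11 a b u v = (b - u) * ((1 - a) *
      ((1 - (1 - p01) * (1 - tau p01 p11 v)) + (1 - p01) * (1 - p01))) := by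
    unfold greedyLoss tau
    ring
  linarith

/-- Leaving the channel least likely to be idle unsensed is better. -/
lemma greedyLoss_le_swap_right {p01 p11 a b u v : ℝ} (hp1 : p11 ≤ p01)
    (hp2 : p01 ≤ 1) (ha0 : 0 ≤ a) (ha : a ≤ 1) (hb : b ≤ 1) (hvu : v ≤ u) :
    greedyLoss p01 p11 a u b v ≤ greedyLoss p01 p11 a v b u := by
  have key : 0 ≤ (u - v) * ((1 - a) + a * ((1 - p01) * (p01 - p11)) * (1 - b)) :=
    mul_nonneg (by linarith) (add_nonneg (by linarith) (mul_nonneg (mul_nonneg ha0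
      (mul_nonneg (by linarith) (by linarith))) (by linarith)))
  have e : greedyLoss p01 p11 a v b u - greedyLoss p01 p11 a u b v =
      (u - v) * ((1 - a) + a * ((1 - p01) * (p01 - p11)) * (1 - b)) := by
    unfold greedyLoss tau
    ring
  linarith

lemma mul_le_mul_of_two_smallest {ι : Type*} {g : ι → ℝ} {m n : ℝ} (k : ι) (hm : 0 ≤ m)
    (hmn : m ≤ n) (hk : m ≤ g k) (hg : ∀ i, i ≠ k → n ≤ g i) {c d : ι} (hcd : c ≠ d) :
    n * m ≤ g c * g d := by
  have hall : ∀ i, m ≤ g i := by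
    intro i
    by_cases h : i = k
    · exact h ▸ hk
    · exact hmn.trans (hg i h)
  by_cases h : c = k
  · rw [mul_comm n m]
    exact mul_le_mul (hall c) (hg d (fun h' => hcd (h.trans h'.symm))) (hm.trans hmn)
      (hm.trans (hall c))
  · exact mul_le_mul (hg c h) (hall d) hm ((hm.trans hmn).trans (hg c h))

lemma policyReward_le_two_sub_greedyLoss {p01 p11 : ℝ} {N : ℕ} {ω : Fin N → ℝ}
    (hp1 : p11 ≤ p01) (hp2 : p01 ≤ 1) (h0 : ∀ i, 0 ≤ ω i) (h1 : ∀ i, ω i ≤ 1)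
    {a b u v : Fin N} (hab : a ≠ b) (hva : v ≠ a) (hvb : v ≠ b)
    (hcover : ∀ i, i = a ∨ i = b ∨ i = u ∨ i = v) (hvu : ω v ≤ ω u)
    {c d : Bool × Bool → Fin N} (hcd : ∀ s, c s ≠ d s) :
    policyReward p01 p11 ω a b c d ≤ 2 - greedyLoss p01 p11 (ω a) (ω b) (ω u) (ω v) := by
  have hmin : ∀ i, i ≠ a → i ≠ b → tau p01 p11 (ω i) ≤ tau p01 p11 (ω v) := by
    intro i hia hib
    rcases hcover i with h | h | h | h
    · exact absurd h hia
    · exact absurd h hib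
    · exact h ▸ tau_anti hp1 hvu
    · rw [h]
  have hv := tau_le hp1 (h0 v)
  have hu := le_tau hp1 (h1 u)
  have hv' := le_tau hp1 (h1 v)
  have huv := tau_anti hp1 hvu
  have htt : (1 - tau p01 p11 (ω u)) * (1 - tau p01 p11 (ω v)) ≤
      (1 - nu p01 p11 ω a b (true, true) (c (true, true))) *
        (1 - nu p01 p11 ω a b (true, true) (d (true, true))) := by
    refine mul_le_mul_of_two_smallest (g := fun i => 1 - nu p01 p11 ω a b (true, true) i) v
      (by linarith) (by linarith) (by simp [nu, hva, hvb]) (fun i hi => ?_) (hcd _)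
    rcases hcover i with h | h | h | h
    · simp only [nu, h, if_true]; linarith
    · simp only [nu, h, hab.symm, if_true, if_false]; linarith
    · simp only [nu, h, if_true]
      split_ifs <;> linarith
    · exact absurd h hi
  have htf : (1 - tau p01 p11 (ω v)) * (1 - p01) ≤
      (1 - nu p01 p11 ω a b (true, false) (c (true, false))) *
        (1 - nu p01 p11 ω a b (true, false) (d (true, false))) := by
    refine mul_le_mul_of_two_smallest (g := fun i => 1 - nu p01 p11 ω a b (true, false) i) b
      (by linarith) (by linarith) (by simp [nu, hab.symm]) (fun i hi => ?_) (hcd _)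
    by_cases h : i = a
    · simp only [nu, h, if_true]; linarith
    · simp only [nu, h, hi, if_false]; linarith [hmin i h hi]
  have hft : (1 - tau p01 p11 (ω v)) * (1 - p01) ≤
      (1 - nu p01 p11 ω a b (false, true) (c (false, true))) *
        (1 - nu p01 p11 ω a b (false, true) (d (false, true))) := by
    refine mul_le_mul_of_two_smallest (g := fun i => 1 - nu p01 p11 ω a b (false, true) i) a
      (by linarith) (by linarith) (by simp [nu]) (fun i hi => ?_) (hcd _)
    by_cases h : i = b
    · simp only [nu, h, hab.symm, if_true, if_false]; linarith
    · simp only [nu, h, hi, if_false]; linarith [hmin i hi h]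
  have hff : (1 - p01) * (1 - p01) ≤
      (1 - nu p01 p11 ω a b (false, false) (c (false, false))) *
        (1 - nu p01 p11 ω a b (false, false) (d (false, false))) := by
    refine mul_le_mul_of_two_smallest (g := fun i => 1 - nu p01 p11 ω a b (false, false) i) a
      (by linarith) le_rfl (by simp [nu]) (fun i hi => ?_) (hcd _)
    by_cases h : i = b
    · simp [nu, h]
    · simp only [nu, h, hi, if_false]; linarith [hmin i hi h]
  have wa := h0 a
  have wb := h0 b
  have wa' : 0 ≤ 1 - ω a := by linarith [h1 a]
  have wb' : 0 ≤ 1 - ω b := by linarith [h1 b]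
  have l1 := mul_le_mul_of_nonneg_left htt (mul_nonneg wa wb)
  have l2 := mul_le_mul_of_nonneg_left htf (mul_nonneg wa wb')
  have l3 := mul_le_mul_of_nonneg_left hft (mul_nonneg wa' wb)
  have l4 := mul_le_mul_of_nonneg_left hff (mul_nonneg wa' wb')
  simp only [policyReward, greedyLoss, outcomeProb, Fintype.sum_prod_type, Fintype.sum_bool,
    if_true, if_false, Bool.false_eq_true]
  linarith


/-- Optimality of the myopic sensing policy for `T = 2`, `k = 2`, `N = 4` when
`p11 < p01`: every two-slot sense-two policy earns at most the myopic reward `R*₋`. -/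
theorem myopic_optimal_T2_k2_neg_N4 (p01 p11 : ℝ)
    (hp0 : 0 ≤ p11) (hp1 : p11 < p01) (hp2 : p01 ≤ 1)
    (ω : Fin 4 → ℝ)
    (hub : ω 0 ≤ 1) (h01 : ω 1 ≤ ω 0) (h12 : ω 2 ≤ ω 1) (h23 : ω 3 ≤ ω 2)
    (hlb : 0 ≤ ω 3)
    (a b : Fin 4) (hab : a ≠ b)
    (c d : (Bool × Bool) → Fin 4) (hcd : ∀ s, c s ≠ d s) :
    policyReward p01 p11 ω a b c d ≤
      (1 - (1 - ω 0) * (1 - ω 1))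
      + ω 0 * ω 1 * (1 - (1 - tau p01 p11 (ω 2)) * (1 - tau p01 p11 (ω 3)))
      + (ω 0 * (1 - ω 1) + (1 - ω 0) * ω 1) *
          (1 - (1 - p01) * (1 - tau p01 p11 (ω 3)))
      + (1 - ω 0) * (1 - ω 1) * (1 - (1 - p01) * (1 - p01)) := by
  have h0 : ∀ i, 0 ≤ ω i := by
    intro i; fin_cases i <;> simp <;> linarith
  have h1 : ∀ i, ω i ≤ 1 := by
    intro i; fin_cases i <;> simp <;> linarith
  have le := hp1.le
  have e01 : 2 - greedyLoss p01 p11 (ω 0) (ω 1) (ω 2) (ω 3) =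
      (1 - (1 - ω 0) * (1 - ω 1))
      + ω 0 * ω 1 * (1 - (1 - tau p01 p11 (ω 2)) * (1 - tau p01 p11 (ω 3)))
      + (ω 0 * (1 - ω 1) + (1 - ω 0) * ω 1) *
          (1 - (1 - p01) * (1 - tau p01 p11 (ω 3)))
      + (1 - ω 0) * (1 - ω 1) * (1 - (1 - p01) * (1 - p01)) := by
    unfold greedyLoss
    ring
  rw [← e01]
  have l02 : greedyLoss p01 p11 (ω 0) (ω 1) (ω 2) (ω 3) ≤
      greedyLoss p01 p11 (ω 0) (ω 2) (ω 1) (ω 3) :=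
    greedyLoss_le_swap_left hp0 le hp2 (h1 0) (h0 3) (h1 3) h12
  have l03 : greedyLoss p01 p11 (ω 0) (ω 2) (ω 1) (ω 3) ≤
      greedyLoss p01 p11 (ω 0) (ω 3) (ω 1) (ω 2) :=
    greedyLoss_le_swap_right le hp2 (h0 0) (h1 0) (h1 1) h23
  have l12 : greedyLoss p01 p11 (ω 2) (ω 0) (ω 1) (ω 3) ≤
      greedyLoss p01 p11 (ω 2) (ω 1) (ω 0) (ω 3) :=
    greedyLoss_le_swap_left hp0 le hp2 (h1 2) (h0 3) (h1 3) h01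
  have l13 : greedyLoss p01 p11 (ω 1) (ω 2) (ω 0) (ω 3) ≤
      greedyLoss p01 p11 (ω 1) (ω 3) (ω 0) (ω 2) :=
    greedyLoss_le_swap_right le hp2 (h0 1) (h1 1) (h1 0) h23
  have l23 : greedyLoss p01 p11 (ω 2) (ω 1) (ω 0) (ω 3) ≤
      greedyLoss p01 p11 (ω 2) (ω 3) (ω 0) (ω 1) :=
    greedyLoss_le_swap_right le hp2 (h0 2) (h1 2) (h1 0) (h23.trans h12)
  have s02 := greedyLoss_comm p01 p11 (ω 0) (ω 2) (ω 1) (ω 3)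
  have s12 := greedyLoss_comm p01 p11 (ω 1) (ω 2) (ω 0) (ω 3)
  have reduce : ∀ u v : Fin 4, v ≠ a → v ≠ b → (∀ i, i = a ∨ i = b ∨ i = u ∨ i = v) →
      ω v ≤ ω u →
      greedyLoss p01 p11 (ω 0) (ω 1) (ω 2) (ω 3) ≤
        greedyLoss p01 p11 (ω a) (ω b) (ω u) (ω v) →
      policyReward p01 p11 ω a b c d ≤
        2 - greedyLoss p01 p11 (ω 0) (ω 1) (ω 2) (ω 3) := by
    intro u v hva hvb hcover hvu hle
    have := policyReward_le_two_sub_greedyLoss le hp2 h0 h1 hab hva hvb hcover hvu hcd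
    linarith
  have pairs : ∀ a b : Fin 4, a ≠ b →
      (a, b) = (0, 1) ∨ (a, b) = (0, 2) ∨ (a, b) = (0, 3) ∨ (a, b) = (1, 2) ∨
      (a, b) = (1, 3) ∨ (a, b) = (2, 3) ∨ (b, a) = (0, 1) ∨ (b, a) = (0, 2) ∨
      (b, a) = (0, 3) ∨ (b, a) = (1, 2) ∨ (b, a) = (1, 3) ∨ (b, a) = (2, 3) := by
    decide
  rcases pairs a b hab with h | h | h | h | h | h | h | h | h | h | h | h <;>
    obtain ⟨rfl, rfl⟩ := Prod.mk.inj h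
  · exact reduce 2 3 (by decide) (by decide) (by decide) (by linarith) (by linarith)
  · exact reduce 1 3 (by decide) (by decide) (by decide) (by linarith) (by linarith)
  · exact reduce 1 2 (by decide) (by decide) (by decide) (by linarith) (by linarith)
  · exact reduce 0 3 (by decide) (by decide) (by decide) (by linarith) (by linarith)
  · exact reduce 0 2 (by decide) (by decide) (by decide) (by linarith) (by linarith)
  · exact reduce 0 1 (by decide) (by decide) (by decide) (by linarith) (by linarith)
  · exact reduce 2 3 (by decide) (by decide) (by decide) (by linarith)
      (greedyLoss_comm ..).le
  · exact reduce 1 3 (by decide) (by decide) (by decide) (by linarith)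
      (by rw [greedyLoss_comm p01 p11 (ω 2) (ω 0)]; linarith)
  · exact reduce 1 2 (by decide) (by decide) (by decide) (by linarith)
      (by rw [greedyLoss_comm p01 p11 (ω 3) (ω 0)]; linarith)
  · exact reduce 0 3 (by decide) (by decide) (by decide) (by linarith)
      (by rw [greedyLoss_comm p01 p11 (ω 2) (ω 1)]; linarith)
  · exact reduce 0 2 (by decide) (by decide) (by decide) (by linarith)
      (by rw [greedyLoss_comm p01 p11 (ω 3) (ω 1)]; linarith)
  · exact reduce 0 1 (by decide) (by decide) (by decide) (by linarith)
      (by rw [greedyLoss_comm p01 p11 (ω 3) (ω 2)]; linarith)
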